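/- arXiv:2411.17615 — 9 statements merged into one kernel-verified Lean document; each statement's English description precedes it below -/
import Mathlib

section
/- (Fan's minimax theorem) Let Z be an arbitrary nonempty set, W a nonempty compact Hausdorff topological space, and F : Z × W → ℝ a function such that for every z ∈ Z the map w ↦ F(z,w) is upper semicontinuous on W. Assume F is convex on Z (for any z₁, z₂ ∈ Z and λ ∈ [0,1] there exists z₀ ∈ Z with F(z₀,w) ≤ λF(z₁,w) + (1−λ)F(z₂,w) for all w ∈ W) and concave on W (for any w₁, w₂ ∈ W and λ ∈ [0,1] there exists w₀ ∈ W with F(z,w₀) ≥ λF(z,w₁) + (1−λ)F(z,w₂) for all z ∈ Z). Then inf_{z∈Z} sup_{w∈W} F(z,w) = sup_{w∈W} inf_{z∈Z} F(z,w), where infima and suprema are taken in the extended reals. -/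
theorem fan_aux {Z W : Type*} [Nonempty W] (F : Z → W → ℝ)
    (hconvex : ∀ z₁ z₂ : Z, ∀ l ∈ Set.Icc (0 : ℝ) 1,
      ∃ z₀ : Z, ∀ w : W, F z₀ w ≤ l * F z₁ w + (1 - l) * F z₂ w)
    (hconcave : ∀ w₁ w₂ : W, ∀ l ∈ Set.Icc (0 : ℝ) 1,
      ∃ w₀ : W, ∀ z : Z, F z w₀ ≥ l * F z w₁ + (1 - l) * F z w₂)
    (c : ℝ) (t : Finset Z) (ht : ∀ w, ∃ z ∈ t, F z w < c) :
    ∃ z₀, ∀ w, F z₀ w ≤ c := by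
  classical
  let P : Set (t → ℝ) := Set.univ.pi fun _ => Set.Ioi 0
  let C : Set (t → ℝ) := {x | ∃ w, ∀ i : t, x i ≤ F i w - c}
  have hPo : IsOpen P := isOpen_set_pi Set.finite_univ fun _ _ => isOpen_Ioi
  have hPc : Convex ℝ P := convex_pi fun _ _ => convex_Ioi 0
  have hCc : Convex ℝ C := by
    rintro x ⟨w₁, h₁⟩ y ⟨w₂, h₂⟩ a b ha hb hab
    obtain ⟨w₀, h₀⟩ := hconcave w₁ w₂ a ⟨ha, by linarith⟩
    refine ⟨w₀, fun i => ?_⟩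
    have e : b = 1 - a := by linarith
    subst e
    have := h₀ i
    have q1 := mul_le_mul_of_nonneg_left (h₁ i) ha
    have q2 := mul_le_mul_of_nonneg_left (h₂ i) hb
    simp only [Pi.add_apply, Pi.smul_apply, smul_eq_mul]
    linarith
  have hd : Disjoint P C := by
    rw [Set.disjoint_left]
    rintro x hx ⟨w, hw⟩
    obtain ⟨z, hz, hlt⟩ := ht w
    have h1 : 0 < x ⟨z, hz⟩ := hx ⟨z, hz⟩ trivial
    have h2 := hw ⟨z, hz⟩
    simp only at h2
    linarith
  obtain ⟨f, u, hfP, hfC⟩ := geometric_hahn_banach_open hPc hPo hCc hd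
  have hf : ∀ x : t → ℝ, f x = ∑ i, x i * f (Pi.single i 1) := by
    intro x
    conv_lhs => rw [pi_eq_sum_univ' x]
    simp [map_sum]
  have hone : ∀ k : ℝ, 0 < k → k * f 1 < u := by
    intro k hk
    have := hfP (k • (1 : t → ℝ)) (fun i _ => by simpa using hk)
    simpa using this
  have hu : 0 ≤ u := by
    by_contra hneg
    push Not at hneg
    have h1 := hone 1 one_pos
    have hf1 : f 1 < 0 := by linarith
    have h2 := hone (u / f 1) (div_pos_of_neg_of_neg hneg hf1)
    rw [div_mul_cancel₀ _ hf1.ne] at h2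
    exact lt_irrefl _ h2
  have hneg : ∀ i : t, f (Pi.single i 1) ≤ 0 := by
    intro i
    by_contra hpos
    push Not at hpos
    have key : ∀ k : ℝ, 0 ≤ k → f 1 + k * f (Pi.single i 1) < u := by
      intro k hk
      have := hfP (1 + k • (Pi.single i 1 : t → ℝ)) (fun j _ => by
        have : 0 ≤ (Pi.single i 1 : t → ℝ) j := by
          by_cases h : j = i
          · subst h; simp
          · simp [h]
        have := mul_nonneg hk this
        simp only [Set.mem_Ioi, Pi.add_apply, Pi.smul_apply, smul_eq_mul, Pi.one_apply]
        linarith)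
      simpa using this
    have h0 := key 0 le_rfl
    have h1 := key ((u - f 1) / f (Pi.single i 1)) (div_nonneg (by linarith) hpos.le)
    rw [div_mul_cancel₀ _ hpos.ne'] at h1
    linarith
  have hf1 : f 1 = ∑ i : t, f (Pi.single i 1) := by simpa using hf 1
  have hf1neg : f 1 < 0 := by
    have hle : f 1 ≤ 0 := hf1 ▸ Finset.sum_nonpos fun i _ => hneg i
    refine lt_of_le_of_ne hle fun h0 => ?_
    have hz : ∀ i : t, f (Pi.single i 1) = 0 := fun i =>
      (Finset.sum_eq_zero_iff_of_nonpos fun i _ => hneg i).1 (hf1 ▸ h0) i (Finset.mem_univ _)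
    obtain ⟨w⟩ := ‹Nonempty W›
    have h1 := hfC (fun i => F i w - c) ⟨w, fun i => le_rfl⟩
    rw [hf] at h1
    simp only [hz, mul_zero, Finset.sum_const_zero] at h1
    have h2 := hone 1 one_pos
    rw [h0] at h2
    linarith
  let K : Set (W → ℝ) := {g | ∃ z, ∀ w, F z w ≤ g w}
  have hK : Convex ℝ K := by
    rintro x ⟨z₁, h₁⟩ y ⟨z₂, h₂⟩ a b ha hb hab
    obtain ⟨z₀, h₀⟩ := hconvex z₁ z₂ a ⟨ha, by linarith⟩
    refine ⟨z₀, fun w => ?_⟩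
    have e : b = 1 - a := by linarith
    subst e
    have := h₀ w
    have q1 := mul_le_mul_of_nonneg_left (h₁ w) ha
    have q2 := mul_le_mul_of_nonneg_left (h₂ w) hb
    simp only [Pi.add_apply, Pi.smul_apply, smul_eq_mul]
    linarith
  have hsum1 : ∑ i : t, f (Pi.single i 1) / f 1 = 1 := by
    rw [← Finset.sum_div, ← hf1, div_self hf1neg.ne]
  have hmem : ∑ i : t, (f (Pi.single i 1) / f 1) • F i ∈ K :=
    hK.sum_mem (fun i _ => div_nonneg_of_nonpos (hneg i) hf1neg.le) hsum1
      (fun i _ => ⟨i, fun w => le_rfl⟩)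
  obtain ⟨z₀, hz₀⟩ := hmem
  refine ⟨z₀, fun w => (hz₀ w).trans ?_⟩
  have h1 := hfC (fun i => F i w - c) ⟨w, fun i => le_rfl⟩
  rw [hf] at h1
  have h2 : (∑ i : t, (F i w - c) * f (Pi.single i 1)) / f 1 ≤ 0 :=
    div_nonpos_of_nonneg_of_nonpos (hu.trans h1) hf1neg.le
  have h3 : (∑ i : t, (F i w - c) * f (Pi.single i 1)) / f 1
      = (∑ i : t, (f (Pi.single i 1) / f 1) * F i w)
        - c * ∑ i : t, f (Pi.single i 1) / f 1 := by
    rw [Finset.sum_div, Finset.mul_sum, ← Finset.sum_sub_distrib]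
    refine Finset.sum_congr rfl fun i _ => ?_
    ring
  rw [hsum1] at h3
  simp only [Finset.sum_apply, Pi.smul_apply, smul_eq_mul]
  linarith

/-- Fan's minimax theorem. -/
theorem fan_minimax {Z W : Type*} [Nonempty Z] [TopologicalSpace W] [CompactSpace W]
    [T2Space W] [Nonempty W] (F : Z → W → ℝ)
    (husc : ∀ z : Z, UpperSemicontinuous (fun w => F z w))
    (hconvex : ∀ z₁ z₂ : Z, ∀ l ∈ Set.Icc (0 : ℝ) 1,
      ∃ z₀ : Z, ∀ w : W, F z₀ w ≤ l * F z₁ w + (1 - l) * F z₂ w)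
    (hconcave : ∀ w₁ w₂ : W, ∀ l ∈ Set.Icc (0 : ℝ) 1,
      ∃ w₀ : W, ∀ z : Z, F z w₀ ≥ l * F z w₁ + (1 - l) * F z w₂) :
    ⨅ z : Z, ⨆ w : W, (F z w : EReal) = ⨆ w : W, ⨅ z : Z, (F z w : EReal) := by
  refine le_antisymm ?_ (iSup_iInf_le_iInf_iSup _)
  by_contra hlt
  push Not at hlt
  obtain ⟨c, hc1, hc2⟩ := EReal.lt_iff_exists_real_btwn.1 hlt
  have hne : (⋂ z, {w | c ≤ F z w}).Nonempty := by
    refine CompactSpace.iInter_nonempty (fun z => (husc z).isClosed_preimage c) fun t => ?_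
    by_contra hemp
    obtain ⟨z₀, hz₀⟩ := fan_aux F hconvex hconcave c t (fun w => by
      by_contra hw
      push Not at hw
      exact hemp ⟨w, by simpa using hw⟩)
    refine absurd hc2 (not_lt.2 ((iInf_le _ z₀).trans (iSup_le fun w => ?_)))
    exact_mod_cast hz₀ w
  obtain ⟨w, hw⟩ := hne
  refine absurd hc1 (not_lt.2 (le_trans (le_iInf fun z => ?_) (le_iSup (fun w => ⨅ z : Z, (F z w : EReal)) w)))
  exact_mod_cast Set.mem_iInter.1 hw z
end

section
/- Let (X,d) be a compact metric space, T : X → X a continuous map, and φ ∈ C(X,ℝ). Then the maximum ergodic average satisfies α(φ) = sup over those x ∈ X for which the limit lim_{n→∞} S_nφ(x)/n exists of that limit, i.e. α(φ) = sup_{x ∈ Reg_{T,φ}} lim_{n→∞} S_nφ(x)/n, where Reg_{T,φ} = {x ∈ X : lim_{n→∞} (1/n)S_nφ(x) exists}. -/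
open MeasureTheory Filter Topology

/-- The Birkhoff sum `S_n φ(x) = ∑_{i=0}^{n-1} φ(T^i x)`. -/
noncomputable def birkhoffAvgSum {X : Type*} [TopologicalSpace X] (T : X → X) (φ : C(X, ℝ)) (n : ℕ) (x : X) : ℝ :=
  ∑ i ∈ Finset.range n, φ (T^[i] x)

/-- The maximum ergodic average `α(φ) = sup_{μ ∈ M_T(X)} ∫ φ dμ`. -/
noncomputable def maxErgAvg {X : Type*} [MetricSpace X] [MeasurableSpace X] [BorelSpace X]
    (T : X → X) (φ : C(X, ℝ)) : ℝ :=
  sSup {r : ℝ | ∃ μ : Measure X, IsProbabilityMeasure μ ∧ μ.map T = μ ∧ r = ∫ x, φ x ∂μ}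

section Helpers

variable {X : Type*} [MetricSpace X] [CompactSpace X]

lemma bas_add (T : X → X) (φ : C(X, ℝ)) (m n : ℕ) (x : X) :
    birkhoffAvgSum T φ (m + n) x = birkhoffAvgSum T φ m x + birkhoffAvgSum T φ n (T^[m] x) :=
  birkhoffSum_add T φ m n x

lemma bas_cont (T : X → X) (hT : Continuous T) (φ : C(X, ℝ)) (n : ℕ) :
    Continuous (birkhoffAvgSum T φ n) := by
  unfold birkhoffAvgSum
  exact continuous_finsetSum _ fun i _ => φ.continuous.comp (hT.iterate i)

lemma bas_abs_le (T : X → X) (φ : C(X, ℝ)) (n : ℕ) (x : X) :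
    |birkhoffAvgSum T φ n x| ≤ n * ‖φ‖ := by
  unfold birkhoffAvgSum
  refine (Finset.abs_sum_le_sum_abs _ _).trans ?_
  refine (Finset.sum_le_card_nsmul _ _ ‖φ‖ fun i _ => φ.norm_coe_le_norm _).trans ?_
  simp

lemma bas_concat (T : X → X) (φ : C(X, ℝ)) (N : ℕ) (c : ℝ)
    (h : ∀ x, ∃ k, 1 ≤ k ∧ k ≤ N ∧ birkhoffAvgSum T φ k x < k * c) (n : ℕ) :
    ∀ x, birkhoffAvgSum T φ n x ≤ n * c + N * (‖φ‖ + |c|) := by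
  induction n using Nat.strong_induction_on with
  | _ n ih =>
    intro x
    rcases le_or_gt n N with hn | hn
    · have h1 := (abs_le.1 (bas_abs_le T φ n x)).2
      have h2 : (n : ℝ) ≤ N := by exact_mod_cast hn
      have h3 : (n : ℝ) * (‖φ‖ + |c|) ≤ N * (‖φ‖ + |c|) := by gcongr
      have h4 : (n : ℝ) * (-|c|) ≤ n * c := by
        gcongr
        exact neg_abs_le c
      linarith
    · obtain ⟨k, hk1, hk2, hk⟩ := h x
      obtain ⟨m, rfl⟩ : ∃ m, n = k + m := ⟨n - k, by omega⟩
      have := ih m (by omega) (T^[k] x)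
      rw [bas_add]
      push_cast
      linarith

/-- The key point: `β` is the limit of `max S_n / n`; it is attained along an orbit. -/
lemma exists_beta [Nonempty X] (T : X → X) (hT : Continuous T) (φ : C(X, ℝ)) :
    ∃ (β : ℝ) (M : ℕ → ℝ) (x : X), (∀ n y, birkhoffAvgSum T φ n y ≤ M n) ∧
      Tendsto (fun n => M n / n) atTop (𝓝 β) ∧
      Tendsto (fun n : ℕ => birkhoffAvgSum T φ n x / n) atTop (𝓝 β) := by
  let M : ℕ → ℝ := fun n => ⨆ y, birkhoffAvgSum T φ n y
  have hMb : ∀ n, BddAbove (Set.range (birkhoffAvgSum T φ n)) := fun n =>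
    ⟨n * ‖φ‖, by rintro _ ⟨y, rfl⟩; exact (abs_le.1 (bas_abs_le T φ n y)).2⟩
  have hM : ∀ n y, birkhoffAvgSum T φ n y ≤ M n := fun n y => le_ciSup (hMb n) y
  have hsub : Subadditive M := fun m n => ciSup_le fun y => by
    rw [bas_add]
    exact add_le_add (hM _ _) (hM _ _)
  have hbdd : BddBelow (Set.range fun n : ℕ => M n / n) := by
    refine ⟨-‖φ‖, ?_⟩
    rintro _ ⟨n, rfl⟩
    rcases Nat.eq_zero_or_pos n with rfl | hn
    · simp
    · have hn' : (0 : ℝ) < n := by exact_mod_cast hn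
      simp only
      rw [le_div_iff₀ hn']
      have y : X := Classical.arbitrary X
      have h1 := (abs_le.1 (bas_abs_le T φ n y)).1
      have h2 := hM n y
      linarith
  set β := hsub.lim with hβ
  have hlim := hsub.tendsto_lim hbdd
  have hle : ∀ n : ℕ, n * β ≤ M n := by
    intro n
    rcases Nat.eq_zero_or_pos n with rfl | hn
    · simp [M, birkhoffAvgSum]
    · have hn' : (0 : ℝ) < n := by exact_mod_cast hn
      have := hsub.lim_le_div hbdd hn.ne'
      rw [le_div_iff₀ hn'] at this
      linarith
  have hfin : ∀ (N : ℕ) (ε : ℝ), 0 < ε →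
      ∃ x, ∀ k, 1 ≤ k → k ≤ N → k * (β - ε) ≤ birkhoffAvgSum T φ k x := by
    intro N ε hε
    by_contra! hcon
    have hc := bas_concat T φ N (β - ε) hcon
    obtain ⟨n, hn⟩ := exists_nat_gt (N * (‖φ‖ + |β - ε|) / ε)
    rw [div_lt_iff₀ hε] at hn
    have h1 : M n ≤ n * (β - ε) + N * (‖φ‖ + |β - ε|) := ciSup_le (hc n)
    have h2 := hle n
    linarith
  let K : ℕ → Set X := fun N =>
    ⋂ k ∈ Set.Icc 1 N, {x | k * (β - 1 / ((N : ℝ) + 1)) ≤ birkhoffAvgSum T φ k x}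
  have hKcl : ∀ N, IsClosed (K N) := fun N =>
    isClosed_biInter fun k _ => isClosed_le continuous_const (bas_cont T hT φ k)
  obtain ⟨x, hx⟩ : (⋂ N, K N).Nonempty := by
    refine IsCompact.nonempty_iInter_of_sequence_nonempty_isCompact_isClosed K ?_ ?_
      (hKcl 0).isCompact hKcl
    · intro N x hx
      simp only [K, Set.mem_iInter, Set.mem_ofPred_eq, Set.mem_Icc] at hx ⊢
      intro k hk
      refine le_trans ?_ (hx k ⟨hk.1, by omega⟩)
      have : (1 : ℝ) / (((N + 1 : ℕ) : ℝ) + 1) ≤ 1 / ((N : ℝ) + 1) := by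
        push_cast
        gcongr
        linarith
      gcongr
    · intro N
      obtain ⟨x, hx⟩ := hfin N (1 / ((N : ℝ) + 1)) (by positivity)
      refine ⟨x, ?_⟩
      simp only [K, Set.mem_iInter, Set.mem_ofPred_eq, Set.mem_Icc]
      exact fun k hk => hx k hk.1 hk.2
  have hlow : ∀ k : ℕ, 1 ≤ k → k * β ≤ birkhoffAvgSum T φ k x := by
    intro k hk
    have ht : Tendsto (fun N : ℕ => k * (β - 1 / ((N : ℝ) + 1))) atTop (𝓝 (k * (β - 0))) :=
      (tendsto_const_nhds.sub tendsto_one_div_add_atTop_nhds_zero_nat).const_mul _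
    rw [sub_zero] at ht
    refine le_of_tendsto ht ?_
    filter_upwards [eventually_ge_atTop k] with N hN
    have := Set.mem_iInter.1 hx N
    simp only [K, Set.mem_iInter, Set.mem_ofPred_eq, Set.mem_Icc] at this
    exact this k ⟨hk, hN⟩
  refine ⟨β, M, x, hM, hlim, ?_⟩
  refine tendsto_of_tendsto_of_tendsto_of_le_of_le' tendsto_const_nhds hlim ?_ ?_
  · filter_upwards [eventually_ge_atTop 1] with n hn
    have hn' : (0 : ℝ) < n := by exact_mod_cast hn
    rw [le_div_iff₀ hn']
    linarith [hlow n hn]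
  · filter_upwards with n
    gcongr
    exact hM n x

variable [MeasurableSpace X] [BorelSpace X]

/-- The empirical measure of the first `n + 1` points of an orbit. -/
noncomputable def empMeas (T : X → X) (x : X) (n : ℕ) : Measure X :=
  ((n + 1 : ℕ) : ENNReal)⁻¹ • ∑ i ∈ Finset.range (n + 1), Measure.dirac (T^[i] x)

lemma empMeas_prob (T : X → X) (x : X) (n : ℕ) : IsProbabilityMeasure (empMeas T x n) := by
  constructor
  simp only [empMeas, Measure.smul_apply, Measure.finsetSum_apply, smul_eq_mul, measure_univ,
    Finset.sum_const, Finset.card_range, nsmul_eq_mul, mul_one]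
  exact ENNReal.inv_mul_cancel (by simp) (ENNReal.natCast_ne_top _)

lemma integral_empMeas (T : X → X) (x : X) (n : ℕ) (f : X → ℝ) (hf : Continuous f) :
    ∫ y, f y ∂(empMeas T x n) = birkhoffAverage ℝ T f (n + 1) x := by
  rw [empMeas, integral_smul_measure, integral_finsetSum_measure]
  · rw [ENNReal.toReal_inv, ENNReal.toReal_natCast]
    simp [birkhoffAverage, birkhoffSum, integral_dirac]
  · intro i _
    exact integrable_dirac (by simp)

/-- Krylov-Bogolyubov along an orbit. -/
lemma exists_invariant (T : X → X) (hT : Continuous T) (φ : C(X, ℝ)) (x : X) (β : ℝ)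
    (h : Tendsto (fun n : ℕ => birkhoffAvgSum T φ n x / n) atTop (𝓝 β)) :
    ∃ μ : Measure X, IsProbabilityMeasure μ ∧ μ.map T = μ ∧ β = ∫ x, φ x ∂μ := by
  let P : ℕ → ProbabilityMeasure X := fun n => ⟨empMeas T x n, empMeas_prob T x n⟩
  let U : Ultrafilter ℕ := hyperfilter ℕ
  have hU : (U : Filter ℕ) ≤ atTop := Nat.hyperfilter_le_atTop
  obtain ⟨μ, -, hμ⟩ := isCompact_univ.ultrafilter_le_nhds (U.map P) (by simp)
  have hP : Tendsto P U (𝓝 μ) := hμ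
  rw [ProbabilityMeasure.tendsto_iff_forall_integral_tendsto] at hP
  have hP' : ∀ f : C(X, ℝ), Tendsto (fun n => birkhoffAverage ℝ T f (n + 1) x) U
      (𝓝 (∫ y, f y ∂(μ : Measure X))) := by
    intro f
    have := hP (BoundedContinuousFunction.mkOfCompact f)
    refine this.congr fun n => ?_
    exact integral_empMeas T x n f f.continuous
  refine ⟨μ, inferInstance, ?_, ?_⟩
  · have : IsProbabilityMeasure ((μ : Measure X).map T) :=
      Measure.isProbabilityMeasure_map hT.measurable.aemeasurable
    apply ext_of_forall_integral_eq_of_IsFiniteMeasure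
    intro f
    rw [integral_map hT.measurable.aemeasurable f.continuous.aestronglyMeasurable]
    have h1 := hP' (f.toContinuousMap.comp ⟨T, hT⟩)
    have h2 := hP' f.toContinuousMap
    have h3 : Tendsto (fun n : ℕ => birkhoffAverage ℝ T f (n + 1) (T x)
        - birkhoffAverage ℝ T f (n + 1) x) U (𝓝 0) :=
      ((tendsto_birkhoffAverage_apply_sub_birkhoffAverage' ℝ f.isBounded_range T x).comp
        (tendsto_add_atTop_nat 1)).mono_left hU
    have h4 := tendsto_nhds_unique (h1.sub h2) (h3.congr fun n => ?_)
    · exact sub_eq_zero.1 h4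
    · congr 1
      simp only [birkhoffAverage, birkhoffSum]
      congr 1
      refine Finset.sum_congr rfl fun i _ => ?_
      change f (T^[i] (T x)) = f (T (T^[i] x))
      rw [← Function.iterate_succ_apply, Function.iterate_succ_apply']
  · refine tendsto_nhds_unique ?_ (hP' φ)
    refine ((h.comp (tendsto_add_atTop_nat 1)).mono_left hU).congr fun n => ?_
    simp [birkhoffAverage, birkhoffSum, birkhoffAvgSum, div_eq_inv_mul]

lemma integral_bas (T : X → X) (hT : Continuous T) (φ : C(X, ℝ)) (μ : Measure X)
    [IsProbabilityMeasure μ] (hμ : μ.map T = μ) (n : ℕ) :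
    ∫ x, birkhoffAvgSum T φ n x ∂μ = n * ∫ x, φ x ∂μ := by
  have hmp : MeasurePreserving T μ μ := ⟨hT.measurable, hμ⟩
  have hint : ∀ f : X → ℝ, Continuous f → Integrable f μ := fun f hf =>
    hf.integrable_of_hasCompactSupport (HasCompactSupport.of_compactSpace f)
  unfold birkhoffAvgSum
  rw [integral_finsetSum _ fun i _ => hint (fun x => φ (T^[i] x)) (φ.continuous.comp (hT.iterate i))]
  rw [Finset.sum_congr rfl (g := fun _ => ∫ x, φ x ∂μ)]
  · simp
  · intro i _
    have hi := hmp.iterate i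
    conv_rhs => rw [← hi.map_eq]
    rw [integral_map hi.measurable.aemeasurable φ.continuous.aestronglyMeasurable]

end Helpers

/-- `α(φ) = sup_{x ∈ Reg_{T,φ}} lim_{n→∞} S_nφ(x)/n`. -/
theorem maxErgAvg_eq_sup_reg {X : Type*} [MetricSpace X] [CompactSpace X] [Nonempty X]
    [MeasurableSpace X] [BorelSpace X] (T : X → X) (hT : Continuous T) (φ : C(X, ℝ)) :
    maxErgAvg T φ =
      sSup {r : ℝ | ∃ x : X, Tendsto (fun n : ℕ => birkhoffAvgSum T φ n x / n) atTop (𝓝 r)} := by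
  obtain ⟨β, M, x, hM, hlim, hx⟩ := exists_beta T hT φ
  have h2 : IsGreatest {r : ℝ | ∃ x : X,
      Tendsto (fun n : ℕ => birkhoffAvgSum T φ n x / n) atTop (𝓝 r)} β := by
    refine ⟨⟨x, hx⟩, ?_⟩
    rintro r ⟨y, hy⟩
    refine le_of_tendsto_of_tendsto' hy hlim fun n => ?_
    gcongr
    exact hM n y
  have h1 : IsGreatest {r : ℝ | ∃ μ : Measure X, IsProbabilityMeasure μ ∧ μ.map T = μ ∧
      r = ∫ x, φ x ∂μ} β := by
    refine ⟨exists_invariant T hT φ x β hx, ?_⟩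
    rintro r ⟨μ, hp, hμ, rfl⟩
    refine ge_of_tendsto hlim ?_
    filter_upwards [eventually_ge_atTop 1] with n hn
    have hn' : (0 : ℝ) < n := by exact_mod_cast hn
    rw [le_div_iff₀ hn', mul_comm, ← integral_bas T hT φ μ hμ n]
    have hi : Integrable (birkhoffAvgSum T φ n) μ :=
      (bas_cont T hT φ n).integrable_of_hasCompactSupport (HasCompactSupport.of_compactSpace _)
    calc ∫ x, birkhoffAvgSum T φ n x ∂μ ≤ ∫ _, M n ∂μ :=
          integral_mono hi (integrable_const _) (hM n)
      _ = M n := by simp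
  rw [maxErgAvg, h1.csSup_eq, h2.csSup_eq]
end

section
/- Let (X,d) be a compact metric space, T : X → X a continuous map, and φ ∈ C(X,ℝ). Then the maximum ergodic average satisfies α(φ) = sup_{x∈X} inf_{n∈ℕ, n≥1} S_nφ(x)/n. -/
open MeasureTheory Filter Topology

lemma bsum_add {X : Type*} [TopologicalSpace X] (T : X → X) (φ : C(X, ℝ)) (m n : ℕ) (x : X) :
    birkhoffAvgSum T φ (m + n) x = birkhoffAvgSum T φ m x + birkhoffAvgSum T φ n (T^[m] x) := by
  unfold birkhoffAvgSum
  rw [Finset.sum_range_add]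
  congr 1
  refine Finset.sum_congr rfl fun i _ => ?_
  rw [add_comm m i, Function.iterate_add_apply]

lemma bsum_cont {X : Type*} [TopologicalSpace X] (T : X → X) (hT : Continuous T) (φ : C(X, ℝ))
    (n : ℕ) : Continuous (birkhoffAvgSum T φ n) := by
  unfold birkhoffAvgSum
  exact continuous_finsetSum _ fun i _ => φ.continuous.comp (hT.iterate i)

lemma bsum_abs_le {X : Type*} [TopologicalSpace X] [CompactSpace X] (T : X → X) (φ : C(X, ℝ))
    (n : ℕ) (x : X) : |birkhoffAvgSum T φ n x| ≤ n * ‖φ‖ := by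
  unfold birkhoffAvgSum
  refine (Finset.abs_sum_le_sum_abs _ _).trans ?_
  refine (Finset.sum_le_card_nsmul _ _ ‖φ‖ fun i _ => φ.norm_coe_le_norm _).trans ?_
  simp

lemma bsum_bdd {X : Type*} [TopologicalSpace X] [CompactSpace X] (T : X → X) (φ : C(X, ℝ))
    (x : X) : BddBelow (Set.range fun n : ℕ+ => birkhoffAvgSum T φ n x / n) := by
  refine ⟨-‖φ‖, ?_⟩
  rintro _ ⟨n, rfl⟩
  have hn : (0 : ℝ) < n := by exact_mod_cast n.pos
  have := (abs_le.1 (bsum_abs_le T φ n x)).1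
  simp only
  rw [le_div_iff₀ hn]
  linarith

/-- Chopping argument. -/
lemma bsum_chop {X : Type*} [MetricSpace X] [CompactSpace X] (T : X → X) (hT : Continuous T)
    (φ : C(X, ℝ)) (c : ℝ) (h : ∀ x, ∃ n : ℕ+, birkhoffAvgSum T φ n x < n * c) :
    ∃ C : ℝ, ∀ (m : ℕ) (x : X), birkhoffAvgSum T φ m x ≤ m * c + C := by
  obtain ⟨t, ht⟩ := isCompact_univ.elim_finite_subcover
    (fun n : ℕ+ => {x : X | birkhoffAvgSum T φ n x < n * c})
    (fun n => isOpen_lt (bsum_cont T hT φ n) continuous_const)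
    (fun x _ => Set.mem_iUnion.2 (h x))
  set N : ℕ := t.sup (fun n : ℕ+ => (n : ℕ)) with hN
  have hK : 0 ≤ ‖φ‖ + |c| := by positivity
  refine ⟨N * (‖φ‖ + |c|), fun m => ?_⟩
  induction m using Nat.strong_induction_on with
  | _ m ih =>
    intro x
    obtain ⟨n, hn, hx⟩ := Set.mem_iUnion₂.1 (ht (Set.mem_univ x))
    have hnN : (n : ℕ) ≤ N := Finset.le_sup (f := fun n : ℕ+ => (n : ℕ)) hn
    have hn0 := n.pos
    simp only [Set.mem_setOf_eq] at hx
    rcases le_or_gt N m with hm | hm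
    · obtain ⟨k, rfl⟩ := Nat.exists_eq_add_of_le (hnN.trans hm)
      rw [bsum_add]
      have := ih k (by omega) (T^[n] x)
      push_cast
      linarith
    · have h1 := (abs_le.1 (bsum_abs_le T φ m x)).2
      have h2 : (m : ℝ) * (‖φ‖ + |c|) ≤ N * (‖φ‖ + |c|) :=
        mul_le_mul_of_nonneg_right (by exact_mod_cast hm.le) hK
      have h3 : (m : ℝ) * (-|c|) ≤ m * c :=
        mul_le_mul_of_nonneg_left (neg_abs_le c) (by positivity)
      nlinarith

lemma integral_bsum {X : Type*} [MetricSpace X] [CompactSpace X]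
    [MeasurableSpace X] [BorelSpace X] (T : X → X) (hT : Continuous T) (φ : C(X, ℝ))
    (μ : Measure X) [IsProbabilityMeasure μ] (hμ : μ.map T = μ) (m : ℕ) :
    ∫ x, birkhoffAvgSum T φ m x ∂μ = m * ∫ x, φ x ∂μ := by
  have hmp : MeasurePreserving T μ μ := ⟨hT.measurable, hμ⟩
  unfold birkhoffAvgSum
  rw [integral_finset_sum]
  · have : ∀ i ∈ Finset.range m, ∫ x, φ (T^[i] x) ∂μ = ∫ x, φ x ∂μ := by
      intro i _
      have h := (hmp.iterate i).map_eq
      conv_rhs => rw [← h]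
      rw [integral_map (hmp.iterate i).measurable.aemeasurable
        φ.continuous.aestronglyMeasurable]
    rw [Finset.sum_congr rfl this]
    simp
  · intro i _
    exact (φ.continuous.comp (hT.iterate i)).integrable_of_hasCompactSupport
      (HasCompactSupport.of_compactSpace _)

lemma exists_inv {X : Type*} [MetricSpace X] [CompactSpace X]
    [MeasurableSpace X] [BorelSpace X] (T : X → X) (hT : Continuous T) (φ : C(X, ℝ)) (x : X) :
    ∃ μ : Measure X, IsProbabilityMeasure μ ∧ μ.map T = μ ∧
      (⨅ n : ℕ+, birkhoffAvgSum T φ n x / n) ≤ ∫ y, φ y ∂μ := by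
  have hprob : ∀ n : ℕ, IsProbabilityMeasure
      (((n + 1 : ℕ) : ENNReal)⁻¹ • ∑ i ∈ Finset.range (n + 1), Measure.dirac (T^[i] x)) := by
    intro n
    constructor
    simp only [Measure.smul_apply, Measure.finsetSum_apply, measure_univ, smul_eq_mul,
      Finset.sum_const, Finset.card_range, nsmul_eq_mul, mul_one]
    exact ENNReal.inv_mul_cancel (by simp) (by simp)
  let E : ℕ → ProbabilityMeasure X := fun n => ⟨_, hprob n⟩
  have hE : ∀ (n : ℕ) (f : C(X, ℝ)),
      ∫ y, f y ∂(E n : Measure X) = birkhoffAvgSum T f (n + 1) x / (n + 1 : ℕ) := by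
    intro n f
    change ∫ y, f y ∂(((n + 1 : ℕ) : ENNReal)⁻¹ •
      ∑ i ∈ Finset.range (n + 1), Measure.dirac (T^[i] x)) = _
    rw [integral_smul_measure, integral_finsetSum_measure]
    · simp only [integral_dirac, birkhoffAvgSum, ENNReal.toReal_inv, ENNReal.toReal_natCast,
        smul_eq_mul]
      rw [div_eq_inv_mul]
    · intro i _
      exact f.continuous.integrable_of_hasCompactSupport (HasCompactSupport.of_compactSpace _)
  let U : Ultrafilter ℕ := hyperfilter ℕ
  have hU : (U : Filter ℕ) ≤ atTop := by
    have := hyperfilter_le_cofinite (α := ℕ)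
    rwa [Nat.cofinite_eq_atTop] at this
  obtain ⟨μ, -, hμ⟩ := isCompact_univ.ultrafilter_le_nhds (U.map E) (by simp)
  have hμ' : Tendsto E U (𝓝 μ) := hμ
  have hlim : ∀ f : C(X, ℝ), Tendsto (fun n : ℕ => birkhoffAvgSum T f (n + 1) x / (n + 1 : ℕ))
      U (𝓝 (∫ y, f y ∂(μ : Measure X))) := by
    intro f
    have := (ProbabilityMeasure.tendsto_iff_forall_integral_tendsto.1 hμ')
      (BoundedContinuousFunction.mkOfCompact f)
    simp only [BoundedContinuousFunction.mkOfCompact_apply] at this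
    simpa only [hE] using this
  refine ⟨μ, inferInstance, ?_, ?_⟩
  · have : IsProbabilityMeasure ((μ : Measure X).map T) :=
      Measure.isProbabilityMeasure_map hT.measurable.aemeasurable
    refine ext_of_forall_integral_eq_of_IsFiniteMeasure fun f => ?_
    rw [integral_map hT.measurable.aemeasurable f.continuous.aestronglyMeasurable]
    have h1 := hlim f.toContinuousMap
    have h2 := hlim (f.toContinuousMap.comp ⟨T, hT⟩)
    have h3 : Tendsto (fun n : ℕ =>
        birkhoffAvgSum T (f.toContinuousMap.comp ⟨T, hT⟩) (n + 1) x / (n + 1 : ℕ)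
        - birkhoffAvgSum T f.toContinuousMap (n + 1) x / (n + 1 : ℕ)) U (𝓝 0) := by
      refine Tendsto.mono_left ?_ hU
      have h4 : Tendsto (fun n : ℕ => (2 * ‖f.toContinuousMap‖) / ((n : ℝ) + 1)) atTop (𝓝 0) :=
        tendsto_const_nhds.div_atTop (tendsto_natCast_atTop_atTop.atTop_add tendsto_const_nhds)
      refine squeeze_zero_norm (fun n => ?_) h4
      have h5 : birkhoffAvgSum T (f.toContinuousMap.comp ⟨T, hT⟩) (n + 1) x
          - birkhoffAvgSum T f.toContinuousMap (n + 1) x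
          = f.toContinuousMap (T^[n + 1] x) - f.toContinuousMap x := by
        unfold birkhoffAvgSum
        rw [← Finset.sum_sub_distrib]
        have := Finset.sum_range_sub (fun i => f.toContinuousMap (T^[i] x)) (n + 1)
        simp only [Function.iterate_succ_apply', Function.iterate_zero, id] at this ⊢
        exact this
      rw [← sub_div, h5, norm_div]
      have h6 : ‖((n + 1 : ℕ) : ℝ)‖ = (n : ℝ) + 1 := by
        rw [Real.norm_natCast]; push_cast; rfl
      rw [h6]
      gcongr
      have a := f.toContinuousMap.norm_coe_le_norm (T^[n + 1] x)
      have b := f.toContinuousMap.norm_coe_le_norm x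
      exact (norm_sub_le _ _).trans (by linarith)
    have h7 := tendsto_nhds_unique (h2.sub h1) h3
    exact sub_eq_zero.1 h7
  · refine ge_of_tendsto' (hlim φ) fun n => ?_
    exact ciInf_le (bsum_bdd T φ x) n.succPNat

/-- `α(φ) = sup_{x∈X} inf_{n≥1} S_nφ(x)/n`. -/
theorem maxErgAvg_eq_sup_inf {X : Type*} [MetricSpace X] [CompactSpace X] [Nonempty X]
    [MeasurableSpace X] [BorelSpace X] (T : X → X) (hT : Continuous T) (φ : C(X, ℝ)) :
    maxErgAvg T φ =
      ⨆ x : X, ⨅ n : ℕ+, birkhoffAvgSum T φ n x / n := by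
  have hbdd : BddAbove (Set.range fun x : X => ⨅ n : ℕ+, birkhoffAvgSum T φ n x / n) := by
    refine ⟨‖φ‖, ?_⟩
    rintro _ ⟨x, rfl⟩
    refine (ciInf_le (bsum_bdd T φ x) 1).trans ?_
    have := (abs_le.1 (bsum_abs_le T φ 1 x)).2
    simpa using this
  have hle : ∀ μ : Measure X, IsProbabilityMeasure μ → μ.map T = μ →
      ∫ x, φ x ∂μ ≤ ⨆ x : X, ⨅ n : ℕ+, birkhoffAvgSum T φ n x / n := by
    intro μ hμ1 hμ
    refine le_of_forall_gt_imp_ge_of_dense fun c hc => ?_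
    obtain ⟨C, hC⟩ := bsum_chop T hT φ c (fun x => by
      obtain ⟨n, hn⟩ := exists_lt_of_ciInf_lt ((le_ciSup hbdd x).trans_lt hc)
      have hn0 : (0 : ℝ) < n := by exact_mod_cast n.pos
      refine ⟨n, ?_⟩
      rw [div_lt_iff₀ hn0] at hn
      linarith)
    have hint : ∀ m : ℕ, (m : ℝ) * ∫ x, φ x ∂μ ≤ m * c + C := by
      intro m
      rw [← integral_bsum T hT φ μ hμ m]
      have := integral_mono (μ := μ) ((bsum_cont T hT φ m).integrable_of_hasCompactSupport
        (HasCompactSupport.of_compactSpace _)) (integrable_const (m * c + C)) (hC m)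
      simpa using this
    by_contra! hlt
    obtain ⟨m, hm⟩ := exists_nat_gt (C / (∫ x, φ x ∂μ - c))
    rw [div_lt_iff₀ (by linarith)] at hm
    have := hint m
    nlinarith
  unfold maxErgAvg
  apply le_antisymm
  · obtain ⟨x⟩ := ‹Nonempty X›
    obtain ⟨μ, h1, h2, -⟩ := exists_inv T hT φ x
    refine csSup_le ⟨_, μ, h1, h2, rfl⟩ ?_
    rintro _ ⟨μ, h1, h2, rfl⟩
    exact hle μ h1 h2
  · refine ciSup_le fun x => ?_
    obtain ⟨μ, h1, h2, h3⟩ := exists_inv T hT φ x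
    refine h3.trans (le_csSup
      ⟨⨆ x : X, ⨅ n : ℕ+, birkhoffAvgSum T φ n x / n, ?_⟩ ⟨μ, h1, h2, rfl⟩)
    rintro _ ⟨μ, h1, h2, rfl⟩
    exact hle μ h1 h2
end

section
/- Let (X,d) be a compact metric space, T : X → X a continuous map, and φ ∈ C(X,ℝ). Then the maximum ergodic average satisfies α(φ) = inf_{ψ∈C(X,ℝ)} sup_{x∈X} (φ(x) + ψ(x) − ψ(T(x))). -/
open MeasureTheory Filter Topology

/-- The sublinear functional `f ↦ inf_ψ sup_x (f + ψ - ψ ∘ T)`. -/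
noncomputable def cobP {X : Type*} [TopologicalSpace X] (T : X → X) (f : C(X, ℝ)) : ℝ :=
  ⨅ ψ : C(X, ℝ), ⨆ x : X, (f x + ψ x - ψ (T x))

section
variable {X : Type*} [MetricSpace X] [CompactSpace X] [Nonempty X]

theorem cob_bddAbove {T : X → X} (hT : Continuous T) (f ψ : C(X, ℝ)) :
    BddAbove (Set.range fun x : X => f x + ψ x - ψ (T x)) :=
  (isCompact_range (by fun_prop)).bddAbove

theorem cob_bddBelow {T : X → X} (hT : Continuous T) (f : C(X, ℝ)) :
    BddBelow (Set.range fun ψ : C(X, ℝ) => ⨆ x : X, (f x + ψ x - ψ (T x))) := by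
  refine ⟨-‖f‖, ?_⟩
  rintro _ ⟨ψ, rfl⟩
  obtain ⟨x, -, hx⟩ := isCompact_univ.exists_isMaxOn Set.univ_nonempty ψ.continuous.continuousOn
  refine le_trans ?_ (le_ciSup (cob_bddAbove hT f ψ) x)
  have h1 : ψ (T x) ≤ ψ x := hx (Set.mem_univ (T x))
  have h2 := (abs_le.1 (f.norm_coe_le_norm x)).1
  linarith

theorem cobP_le {T : X → X} (hT : Continuous T) (f ψ : C(X, ℝ)) (c : ℝ)
    (h : ∀ x, f x + ψ x - ψ (T x) ≤ c) : cobP T f ≤ c :=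
  (ciInf_le (cob_bddBelow hT f) ψ).trans (ciSup_le h)

theorem cobP_exists {T : X → X} (hT : Continuous T) (f : C(X, ℝ)) (ε : ℝ) (hε : 0 < ε) :
    ∃ ψ : C(X, ℝ), ∀ x, f x + ψ x - ψ (T x) ≤ cobP T f + ε := by
  obtain ⟨ψ, hψ⟩ := exists_lt_of_ciInf_lt (lt_add_of_pos_right (cobP T f) hε)
  exact ⟨ψ, fun x => (le_ciSup (cob_bddAbove hT f ψ) x).trans hψ.le⟩

theorem cobP_add {T : X → X} (hT : Continuous T) (f g : C(X, ℝ)) :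
    cobP T (f + g) ≤ cobP T f + cobP T g := by
  refine le_of_forall_pos_le_add fun ε hε => ?_
  obtain ⟨ψ, hψ⟩ := cobP_exists hT f (ε / 2) (by linarith)
  obtain ⟨ρ, hρ⟩ := cobP_exists hT g (ε / 2) (by linarith)
  refine cobP_le hT _ (ψ + ρ) _ fun x => ?_
  have := hψ x
  have := hρ x
  simp only [ContinuousMap.add_apply]
  linarith

theorem cobP_smul_le {T : X → X} (hT : Continuous T) (c : ℝ) (hc : 0 < c) (f : C(X, ℝ)) :
    cobP T (c • f) ≤ c * cobP T f := by
  refine le_of_forall_pos_le_add fun ε hε => ?_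
  obtain ⟨ψ, hψ⟩ := cobP_exists hT f (ε / c) (by positivity)
  refine cobP_le hT _ (c • ψ) _ fun x => ?_
  have := mul_le_mul_of_nonneg_left (hψ x) hc.le
  have h2 : c * (ε / c) = ε := by field_simp
  simp only [ContinuousMap.smul_apply, smul_eq_mul]
  nlinarith

theorem cobP_smul {T : X → X} (hT : Continuous T) (c : ℝ) (hc : 0 < c) (f : C(X, ℝ)) :
    cobP T (c • f) = c * cobP T f := by
  refine le_antisymm (cobP_smul_le hT c hc f) ?_
  have h := cobP_smul_le hT c⁻¹ (by positivity) (c • f)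
  rw [smul_smul, inv_mul_cancel₀ hc.ne', one_smul] at h
  have := mul_le_mul_of_nonneg_left h hc.le
  rwa [← mul_assoc, mul_inv_cancel₀ hc.ne', one_mul] at this

theorem cobP_zero {T : X → X} (hT : Continuous T) : cobP T (0 : C(X, ℝ)) = 0 := by
  have := cobP_smul hT 2 (by norm_num) 0
  rw [smul_zero] at this
  linarith

theorem exists_functional {T : X → X} (hT : Continuous T) (φ : C(X, ℝ)) :
    ∃ L : C(X, ℝ) →ₗ[ℝ] ℝ, L φ = cobP T φ ∧ ∀ f, L f ≤ cobP T f := by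
  have H : ∀ c : ℝ, c • φ = 0 → (RingHom.id ℝ) c • cobP T φ = 0 := by
    intro c hc
    rcases smul_eq_zero.1 hc with h | h
    · simp [h]
    · simp [h, cobP_zero hT]
  obtain ⟨g, hg, hg'⟩ := exists_extension_of_le_sublinear
    (LinearPMap.mkSpanSingleton' φ (cobP T φ) H) (cobP T) (cobP_smul hT) (cobP_add hT) (by
      rintro ⟨x, hx⟩
      obtain ⟨c, rfl⟩ := Submodule.mem_span_singleton.1 hx
      rw [LinearPMap.mkSpanSingleton'_apply]
      simp only [RingHom.id_apply, smul_eq_mul]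
      rcases lt_trichotomy c 0 with h | h | h
      · have h1 := cobP_add hT (c • φ) ((-c) • φ)
        rw [cobP_smul hT (-c) (by linarith), ← add_smul, add_neg_cancel, zero_smul,
          cobP_zero hT] at h1
        linarith
      · simp [h, cobP_zero hT]
      · exact (cobP_smul hT c h φ).ge)
  refine ⟨g, ?_, hg'⟩
  have := hg ⟨φ, Submodule.mem_span_singleton_self φ⟩
  exact this.trans (LinearPMap.mkSpanSingleton'_apply_self φ (cobP T φ) H _)

theorem exists_measure [MeasurableSpace X] [BorelSpace X] (L : C(X, ℝ) →ₗ[ℝ] ℝ)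
    (hpos : ∀ f : C(X, ℝ), (∀ x, 0 ≤ f x) → 0 ≤ L f) (h1 : L 1 = 1) :
    ∃ μ : Measure X, IsProbabilityMeasure μ ∧ ∀ f : C(X, ℝ), ∫ x, f x ∂μ = L f := by
  let Λ : CompactlySupportedContinuousMap X ℝ →ₚ[ℝ] ℝ :=
  { toFun := fun f => L f.toContinuousMap
    map_add' := fun f g => L.map_add f.toContinuousMap g.toContinuousMap
    map_smul' := fun c f => L.map_smul c f.toContinuousMap
    monotone' := by
      intro f g hfg
      have := hpos (g.toContinuousMap - f.toContinuousMap) (fun x => sub_nonneg.2 (hfg x))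
      rw [map_sub] at this
      exact sub_nonneg.1 this }
  have key : ∀ f : C(X, ℝ), ∫ x, f x ∂(RealRMK.rieszMeasure Λ) = L f := fun f =>
    RealRMK.integral_rieszMeasure Λ
      { toContinuousMap := f, hasCompactSupport' := HasCompactSupport.of_compactSpace f }
  refine ⟨RealRMK.rieszMeasure Λ, ?_, key⟩
  have h := key 1
  rw [h1] at h
  simp only [ContinuousMap.one_apply, integral_const, smul_eq_mul, mul_one] at h
  constructor
  rw [measureReal_def] at h
  rw [← ENNReal.ofReal_toReal (measure_ne_top (RealRMK.rieszMeasure Λ) Set.univ), h]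
  simp

end

/-- `α(φ) = inf_{ψ∈C(X,ℝ)} sup_{x∈X} (φ(x) + ψ(x) − ψ(T x))`. -/
theorem maxErgAvg_eq_inf_sup_coboundary {X : Type*} [MetricSpace X] [CompactSpace X]
    [Nonempty X] [MeasurableSpace X] [BorelSpace X] (T : X → X) (hT : Continuous T)
    (φ : C(X, ℝ)) :
    maxErgAvg T φ = ⨅ ψ : C(X, ℝ), ⨆ x : X, (φ x + ψ x - ψ (T x)) := by
  change maxErgAvg T φ = cobP T φ
  have hint : ∀ (μ : Measure X) [IsProbabilityMeasure μ] (f : X → ℝ), Continuous f →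
      Integrable f μ := fun μ _ f hf =>
    hf.integrable_of_hasCompactSupport (HasCompactSupport.of_compactSpace f)
  have hub : ∀ r ∈ {r : ℝ | ∃ μ : Measure X, IsProbabilityMeasure μ ∧ μ.map T = μ ∧
      r = ∫ x, φ x ∂μ}, r ≤ cobP T φ := by
    rintro r ⟨μ, hμ, hinv, rfl⟩
    refine le_of_forall_pos_le_add fun ε hε => ?_
    obtain ⟨ψ, hψ⟩ := cobP_exists hT φ ε hε
    have e : ∫ x, ψ (T x) ∂μ = ∫ x, ψ x ∂μ := by
      conv_rhs => rw [← hinv]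
      rw [integral_map hT.aemeasurable ψ.continuous.aestronglyMeasurable]
    have h2 : ∫ x, (φ x + ψ x - ψ (T x)) ∂μ ≤ ∫ _, (cobP T φ + ε) ∂μ :=
      integral_mono (hint μ _ (by fun_prop)) (integrable_const _) hψ
    rw [integral_sub (hint μ _ (by fun_prop)) (hint μ _ (by fun_prop)),
      integral_add (hint μ _ (by fun_prop)) (hint μ _ (by fun_prop)), e] at h2
    simp only [integral_const, probReal_univ, one_smul] at h2
    linarith
  obtain ⟨L, hLφ, hL⟩ := exists_functional hT φ
  have hneg : ∀ (f ψ : C(X, ℝ)) (c : ℝ), (∀ x, f x + ψ x - ψ (T x) ≤ c) → L f ≤ c :=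
    fun f ψ c h => (hL f).trans (cobP_le hT f ψ c h)
  obtain ⟨μ, hμ, hμL⟩ := exists_measure L
    (by
      intro f hf
      have := hneg (-f) 0 0 (fun x => by simpa using hf x)
      rw [map_neg] at this
      linarith)
    (by
      have h1 := hneg 1 0 1 (fun x => by simp)
      have h2 := hneg (-1) 0 (-1) (fun x => by simp)
      rw [map_neg] at h2
      linarith)
  have hinv : μ.map T = μ := by
    have := Measure.isProbabilityMeasure_map (μ := μ) hT.aemeasurable
    refine ext_of_forall_integral_eq_of_IsFiniteMeasure fun f => ?_
    rw [integral_map hT.aemeasurable f.continuous.aestronglyMeasurable]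
    let g : C(X, ℝ) := f.toContinuousMap
    let gT : C(X, ℝ) := g.comp ⟨T, hT⟩
    have h1 := hneg (g - gT) (-g) 0 (fun x => by
      simp only [gT, ContinuousMap.sub_apply, ContinuousMap.neg_apply, ContinuousMap.comp_apply,
        ContinuousMap.coe_mk]
      linarith)
    have h2 := hneg (gT - g) g 0 (fun x => by simp [gT])
    rw [map_sub] at h1 h2
    have e1 : ∫ x, f (T x) ∂μ = L gT := hμL gT
    have e2 : ∫ x, f x ∂μ = L g := hμL g
    rw [e1, e2]
    linarith
  refine le_antisymm (csSup_le ⟨_, μ, hμ, hinv, rfl⟩ hub) ?_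
  exact le_csSup ⟨_, hub⟩ ⟨μ, hμ, hinv, by rw [hμL, hLφ]⟩
end

section
/- Let X be a compact metric space and let Γ : C(X,ℝ) → ℝ be a pressure function, i.e. Γ satisfies monotonicity (φ ≤ ψ implies Γ(φ) ≤ Γ(ψ)), translation invariance (Γ(φ + c) = Γ(φ) + c for every constant c ∈ ℝ), and convexity (Γ(λφ + (1−λ)ψ) ≤ λΓ(φ) + (1−λ)Γ(ψ) for λ ∈ [0,1]). Define A_Γ = {ξ ∈ C(X,ℝ) : Γ(−ξ) ≤ 0} and, for each Borel probability measure μ on X, 𝔥(μ) = inf_{ξ∈A_Γ} ∫ξ dμ (taken in the extended reals). Then for every μ ∈ M(X) and every φ ∈ C(X,ℝ), 𝔥(μ) + ∫φ dμ ≤ Γ(φ). -/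
open MeasureTheory

/-- The generalized entropy `𝔥(μ) = inf_{ξ ∈ A_Γ} ∫ ξ dμ` (in the extended reals),
where `A_Γ = {ξ ∈ C(X,ℝ) : Γ(−ξ) ≤ 0}`. -/
noncomputable def genEntropy {X : Type*} [TopologicalSpace X] [MeasurableSpace X]
    (Γ : C(X, ℝ) → ℝ) (μ : Measure X) : EReal :=
  ⨅ ξ ∈ {ξ : C(X, ℝ) | Γ (-ξ) ≤ 0}, ((∫ x, ξ x ∂μ : ℝ) : EReal)

/-- For every Borel probability measure `μ` and `φ ∈ C(X,ℝ)`, `𝔥(μ) + ∫φ dμ ≤ Γ(φ)`. -/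
theorem genEntropy_add_integral_le {X : Type*} [MetricSpace X] [CompactSpace X] [Nonempty X]
    [MeasurableSpace X] [BorelSpace X] (Γ : C(X, ℝ) → ℝ)
    (hmono : ∀ φ ψ : C(X, ℝ), (∀ x, φ x ≤ ψ x) → Γ φ ≤ Γ ψ)
    (htrans : ∀ (φ : C(X, ℝ)) (c : ℝ), Γ (φ + ContinuousMap.const X c) = Γ φ + c)
    (hconv : ∀ φ ψ : C(X, ℝ), ∀ l ∈ Set.Icc (0 : ℝ) 1,
      Γ (l • φ + (1 - l) • ψ) ≤ l * Γ φ + (1 - l) * Γ ψ)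
    (μ : Measure X) [IsProbabilityMeasure μ] (φ : C(X, ℝ)) :
    genEntropy Γ μ + ((∫ x, φ x ∂μ : ℝ) : EReal) ≤ (Γ φ : EReal) := by
  have hmem : Γ (-(ContinuousMap.const X (Γ φ) - φ)) ≤ 0 := by
    have h := htrans φ (-Γ φ)
    have e : -(ContinuousMap.const X (Γ φ) - φ) = φ + ContinuousMap.const X (-Γ φ) := by
      ext x
      simp
      ring
    rw [e, h]
    simp
  have hint : Integrable (fun x => φ x) μ :=
    φ.continuous.integrable_of_hasCompactSupport (HasCompactSupport.of_compactSpace _)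
  have hI : ∫ x, (ContinuousMap.const X (Γ φ) - φ) x ∂μ = Γ φ - ∫ x, φ x ∂μ := by
    simp only [ContinuousMap.sub_apply, ContinuousMap.const_apply]
    rw [integral_sub (integrable_const _) hint]
    simp
  have hle : genEntropy Γ μ ≤ ((Γ φ - ∫ x, φ x ∂μ : ℝ) : EReal) := by
    rw [← hI]
    exact iInf₂_le (ContinuousMap.const X (Γ φ) - φ) hmem
  calc genEntropy Γ μ + ((∫ x, φ x ∂μ : ℝ) : EReal)
      ≤ ((Γ φ - ∫ x, φ x ∂μ : ℝ) : EReal) + ((∫ x, φ x ∂μ : ℝ) : EReal) := by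
        gcongr
    _ = (Γ φ : EReal) := by
        rw [← EReal.coe_add, sub_add_cancel]
end

section
/- (Abstract variational principle) Let X be a compact metric space and let Γ : C(X,ℝ) → ℝ be a pressure function, i.e. Γ satisfies monotonicity (φ ≤ ψ implies Γ(φ) ≤ Γ(ψ)), translation invariance (Γ(φ + c) = Γ(φ) + c for every constant c ∈ ℝ), and convexity (Γ(λφ + (1−λ)ψ) ≤ λΓ(φ) + (1−λ)Γ(ψ) for λ ∈ [0,1]). Define A_Γ = {ξ ∈ C(X,ℝ) : Γ(−ξ) ≤ 0} and, for each Borel probability measure μ on X, 𝔥(μ) = inf_{ξ∈A_Γ} ∫ξ dμ. Then for every φ ∈ C(X,ℝ), Γ(φ) = sup_{μ∈M(X)} ( 𝔥(μ) + ∫φ dμ ), where M(X) denotes the set of Borel probability measures on X. -/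
open MeasureTheory

/-- Riesz representation on a compact space, for normalized positive functionals. -/
lemma exists_probabilityMeasure_of_positive {X : Type*} [MetricSpace X] [CompactSpace X]
    [MeasurableSpace X] [BorelSpace X] (L : C(X, ℝ) →ₗ[ℝ] ℝ)
    (hpos : ∀ g : C(X, ℝ), (∀ x, 0 ≤ g x) → 0 ≤ L g) (hone : L (ContinuousMap.const X 1) = 1) :
    ∃ μ : ProbabilityMeasure X, ∀ g : C(X, ℝ), ∫ x, g x ∂(μ : Measure X) = L g := by
  let Λ : CompactlySupportedContinuousMap X ℝ →ₚ[ℝ] ℝ :=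
    PositiveLinearMap.mk₀
      { toFun := fun g => L g.toContinuousMap
        map_add' := fun g g' => L.map_add g.toContinuousMap g'.toContinuousMap
        map_smul' := fun c g => L.map_smul c g.toContinuousMap }
      (fun g hg => hpos g.toContinuousMap hg)
  have key : ∀ g : C(X, ℝ), ∫ x, g x ∂(RealRMK.rieszMeasure Λ) = L g := fun g =>
    RealRMK.integral_rieszMeasure Λ
      (⟨g, HasCompactSupport.of_compactSpace _⟩ : CompactlySupportedContinuousMap X ℝ)
  have hp : IsProbabilityMeasure (RealRMK.rieszMeasure Λ) := by
    have h1 := key (ContinuousMap.const X 1)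
    rw [hone] at h1
    simp only [ContinuousMap.const_apply, integral_const, smul_eq_mul, mul_one] at h1
    constructor
    rw [Measure.real, ENNReal.toReal_eq_one_iff] at h1
    exact h1
  exact ⟨⟨_, hp⟩, key⟩

/-- Abstract variational principle: `Γ(φ) = sup_{μ∈M(X)} ( 𝔥(μ) + ∫φ dμ )`. -/
theorem abstract_variational_principle {X : Type*} [MetricSpace X] [CompactSpace X] [Nonempty X]
    [MeasurableSpace X] [BorelSpace X] (Γ : C(X, ℝ) → ℝ)
    (hmono : ∀ φ ψ : C(X, ℝ), (∀ x, φ x ≤ ψ x) → Γ φ ≤ Γ ψ)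
    (htrans : ∀ (φ : C(X, ℝ)) (c : ℝ), Γ (φ + ContinuousMap.const X c) = Γ φ + c)
    (hconv : ∀ φ ψ : C(X, ℝ), ∀ l ∈ Set.Icc (0 : ℝ) 1,
      Γ (l • φ + (1 - l) • ψ) ≤ l * Γ φ + (1 - l) * Γ ψ)
    (φ : C(X, ℝ)) :
    (Γ φ : EReal) =
      ⨆ μ : ProbabilityMeasure X,
        (genEntropy Γ (μ : Measure X) + ((∫ x, φ x ∂(μ : Measure X) : ℝ) : EReal)) := by
  apply le_antisymm
  · have hlip : LipschitzWith 1 Γ := by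
      refine LipschitzWith.of_le_add fun f g => ?_
      rw [← htrans]
      refine hmono _ _ fun x => ?_
      have h := ContinuousMap.dist_apply_le_dist (f := f) (g := g) x
      rw [Real.dist_eq] at h
      have := le_abs_self (f x - g x)
      simp only [ContinuousMap.add_apply, ContinuousMap.const_apply]
      linarith
    have hopen : IsOpen {ψ : C(X, ℝ) | Γ ψ < Γ φ} :=
      isOpen_lt hlip.continuous continuous_const
    have hcvx : Convex ℝ {ψ : C(X, ℝ) | Γ ψ < Γ φ} := by
      intro f hf g hg a b ha hb hab
      simp only [Set.mem_setOf_eq] at hf hg ⊢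
      obtain rfl : b = 1 - a := by linarith
      have h := hconv f g a ⟨ha, by linarith⟩
      refine h.trans_lt ?_
      rcases ha.eq_or_lt with h0 | h0
      · subst h0; simpa using hg
      · nlinarith
    obtain ⟨f, hf⟩ := geometric_hahn_banach_open_point hcvx hopen (x := φ) (by simp)
    have hc : ∀ c : ℝ, f (ContinuousMap.const X c) = c * f (ContinuousMap.const X 1) := by
      intro c
      have : ContinuousMap.const X c = c • ContinuousMap.const X (1 : ℝ) := by ext; simp
      rw [this, map_smul, smul_eq_mul]
    have hf1 : 0 < f (ContinuousMap.const X 1) := by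
      have h := hf (φ + ContinuousMap.const X (-1)) (by
        simp only [Set.mem_setOf_eq, htrans]; linarith)
      rw [map_add, hc] at h
      linarith
    set k := f (ContinuousMap.const X 1) with hk
    have hsub : ∀ ψ : C(X, ℝ), k⁻¹ * f ψ - k⁻¹ * f φ ≤ Γ ψ - Γ φ := by
      intro ψ
      refine le_of_forall_pos_le_add fun ε hε => ?_
      have h := hf (ψ + ContinuousMap.const X (Γ φ - Γ ψ - ε)) (by
        simp only [Set.mem_setOf_eq, htrans]; linarith)
      rw [map_add, hc] at h
      have h2 := mul_lt_mul_of_pos_left h (inv_pos.2 hf1)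
      have h3 : k⁻¹ * (f ψ + (Γ φ - Γ ψ - ε) * k) = k⁻¹ * f ψ + (Γ φ - Γ ψ - ε) := by
        field_simp
      linarith
    obtain ⟨μ, hμ⟩ := exists_probabilityMeasure_of_positive (k⁻¹ • f.toLinearMap)
      (by
        intro g hg
        have h := hsub (φ - g)
        have h2 := hmono (φ - g) φ (fun x => by
          have := hg x
          simp only [ContinuousMap.sub_apply]; linarith)
        rw [map_sub, mul_sub] at h
        change 0 ≤ k⁻¹ * f g
        linarith)
      (by
        change k⁻¹ * k = 1
        exact inv_mul_cancel₀ hf1.ne')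
    have hμ' : ∀ g : C(X, ℝ), ∫ x, g x ∂(μ : Measure X) = k⁻¹ * f g := hμ
    refine le_trans ?_ (le_iSup _ μ)
    have hE : ((Γ φ - k⁻¹ * f φ : ℝ) : EReal) ≤ genEntropy Γ (μ : Measure X) := by
      refine le_iInf₂ fun ξ hξ => ?_
      rw [hμ', EReal.coe_le_coe_iff]
      have h := hsub (-ξ)
      have hξ' : Γ (-ξ) ≤ 0 := hξ
      rw [map_neg, mul_neg] at h
      linarith
    have h := add_le_add_left hE ((k⁻¹ * f φ : ℝ) : EReal)
    rw [← EReal.coe_add, sub_add_cancel] at h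
    rw [hμ']
    exact h
  · refine iSup_le fun μ => ?_
    have hE : genEntropy Γ (μ : Measure X) ≤
        ((Γ φ - ∫ x, φ x ∂(μ : Measure X) : ℝ) : EReal) := by
      refine (iInf₂_le (ContinuousMap.const X (Γ φ) - φ) ?_).trans ?_
      · have : -(ContinuousMap.const X (Γ φ) - φ) = φ + ContinuousMap.const X (-Γ φ) := by
          ext; simp; ring
        simp only [Set.mem_setOf_eq]
        rw [this, htrans]; linarith
      · rw [EReal.coe_le_coe_iff]
        have hi : Integrable (fun x => φ x) (μ : Measure X) :=
          φ.continuous.integrable_of_hasCompactSupport (HasCompactSupport.of_compactSpace _)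
        simp only [ContinuousMap.sub_apply, ContinuousMap.const_apply]
        rw [integral_sub (integrable_const _) hi]
        simp
    have h := add_le_add_left hE ((∫ x, φ x ∂(μ : Measure X) : ℝ) : EReal)
    rw [← EReal.coe_add, sub_add_cancel] at h
    exact h
end

section
/- Let X be a compact metric space and let Γ : C(X,ℝ) → ℝ be a pressure function, i.e. Γ satisfies monotonicity (φ ≤ ψ implies Γ(φ) ≤ Γ(ψ)), translation invariance (Γ(φ + c) = Γ(φ) + c for every constant c ∈ ℝ), and convexity (Γ(λφ + (1−λ)ψ) ≤ λΓ(φ) + (1−λ)Γ(ψ) for λ ∈ [0,1]). Define A_Γ = {ξ ∈ C(X,ℝ) : Γ(−ξ) ≤ 0} and, for each Borel probability measure μ on X, 𝔥(μ) = inf_{ξ∈A_Γ} ∫ξ dμ. Then for every Borel probability measure μ on X, 𝔥(μ) = inf_{φ∈C(X,ℝ)} ( Γ(φ) − ∫φ dμ ), the infima being taken in the extended reals. -/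
open MeasureTheory

/-- `𝔥(μ) = inf_{φ∈C(X,ℝ)} ( Γ(φ) − ∫φ dμ )`. -/
theorem genEntropy_eq_inf {X : Type*} [MetricSpace X] [CompactSpace X] [Nonempty X]
    [MeasurableSpace X] [BorelSpace X] (Γ : C(X, ℝ) → ℝ)
    (hmono : ∀ φ ψ : C(X, ℝ), (∀ x, φ x ≤ ψ x) → Γ φ ≤ Γ ψ)
    (htrans : ∀ (φ : C(X, ℝ)) (c : ℝ), Γ (φ + ContinuousMap.const X c) = Γ φ + c)
    (hconv : ∀ φ ψ : C(X, ℝ), ∀ l ∈ Set.Icc (0 : ℝ) 1,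
      Γ (l • φ + (1 - l) • ψ) ≤ l * Γ φ + (1 - l) * Γ ψ)
    (μ : Measure X) [IsProbabilityMeasure μ] :
    genEntropy Γ μ = ⨅ φ : C(X, ℝ), ((Γ φ - ∫ x, φ x ∂μ : ℝ) : EReal) := by
  unfold genEntropy
  apply le_antisymm
  · refine le_iInf fun φ => ?_
    have hmem : (ContinuousMap.const X (Γ φ) - φ) ∈ {ξ : C(X, ℝ) | Γ (-ξ) ≤ 0} := by
      have h := htrans φ (-Γ φ)
      have e : -(ContinuousMap.const X (Γ φ) - φ) = φ + ContinuousMap.const X (-Γ φ) := by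
        ext x
        simp
        ring
      simp only [Set.mem_setOf_eq]
      rw [e, h]
      simp
    refine (iInf₂_le _ hmem).trans ?_
    have hi : Integrable (fun x => φ x) μ :=
      φ.continuous.integrable_of_hasCompactSupport (HasCompactSupport.of_compactSpace _)
    have : ∫ x, (ContinuousMap.const X (Γ φ) - φ) x ∂μ = Γ φ - ∫ x, φ x ∂μ := by
      simp only [ContinuousMap.sub_apply, ContinuousMap.const_apply]
      rw [integral_sub (integrable_const _) hi]
      simp
    rw [this]
  · refine le_iInf₂ fun ξ hξ => ?_
    refine (iInf_le _ (-ξ)).trans ?_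
    simp only [Set.mem_setOf_eq] at hξ
    rw [EReal.coe_le_coe_iff]
    simp only [ContinuousMap.neg_apply, integral_neg]
    linarith
end

section
/- Let X be a compact metric space, T : X → X a continuous map, and let Γ : C(X,ℝ) → ℝ be a pressure function (satisfying monotonicity, translation invariance, and convexity) that in addition satisfies the cohomology invariance condition Γ(φ + ψ − ψ∘T) = Γ(φ) = Γ(φ + ψ∘T − ψ) for all φ, ψ ∈ C(X,ℝ). Define A_Γ = {ξ ∈ C(X,ℝ) : Γ(−ξ) ≤ 0} and 𝔥(μ) = inf_{ξ∈A_Γ} ∫ξ dμ. Then for every φ ∈ C(X,ℝ), Γ(φ) = sup_{μ∈M_T(X)} ( 𝔥(μ) + ∫φ dμ ), where M_T(X) denotes the set of T-invariant Borel probability measures on X. -/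
open MeasureTheory

open scoped CompactlySupported in
/-- Riesz representation on a compact space, for a positive normalised functional. -/
lemma exists_prob_of_positive {X : Type*} [MetricSpace X] [CompactSpace X]
    [MeasurableSpace X] [BorelSpace X] (L : C(X, ℝ) →ₗ[ℝ] ℝ)
    (hpos : ∀ ψ : C(X, ℝ), (∀ x, 0 ≤ ψ x) → 0 ≤ L ψ)
    (hone : L (ContinuousMap.const X 1) = 1) :
    ∃ μ : ProbabilityMeasure X, ∀ ψ : C(X, ℝ), ∫ x, ψ x ∂(μ : Measure X) = L ψ := by
  let J : C_c(X, ℝ) →ₗ[ℝ] ℝ :=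
    { toFun := fun f => L (f : C(X, ℝ))
      map_add' := fun f g => by rw [← map_add]; rfl
      map_smul' := fun c f => by rw [RingHom.id_apply, ← map_smul]; rfl }
  let Λ : C_c(X, ℝ) →ₚ[ℝ] ℝ := PositiveLinearMap.mk₀ J (fun f hf => hpos _ (fun x => hf x))
  have key : ∀ ψ : C(X, ℝ), ∫ x, ψ x ∂(RealRMK.rieszMeasure Λ) = L ψ := fun ψ =>
    RealRMK.integral_rieszMeasure Λ (CompactlySupportedContinuousMap.continuousMapEquiv ψ)
  have hp : IsProbabilityMeasure (RealRMK.rieszMeasure Λ) := by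
    have h := key (ContinuousMap.const X 1)
    rw [hone] at h
    simp only [ContinuousMap.const_apply, integral_const, smul_eq_mul, mul_one] at h
    exact ⟨by
      rw [← ENNReal.toReal_eq_one_iff]
      exact h⟩
  exact ⟨⟨_, hp⟩, key⟩

/-- A continuous convex function has a subgradient at every point. -/
lemma exists_subgradient {E : Type*} [NormedAddCommGroup E] [NormedSpace ℝ E] (Γ : E → ℝ)
    (hc : Continuous Γ) (hconv : ConvexOn ℝ Set.univ Γ) (φ : E) :
    ∃ L : E →ₗ[ℝ] ℝ, ∀ ψ, L ψ - L φ ≤ Γ ψ - Γ φ := by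
  have h1 := hconv.convex_strict_epigraph
  have h2 : IsOpen {p : E × ℝ | p.1 ∈ Set.univ ∧ Γ p.1 < p.2} := by
    simp only [Set.mem_univ, true_and]
    exact isOpen_lt (hc.comp continuous_fst) continuous_snd
  obtain ⟨f, hf⟩ := geometric_hahn_banach_open_point (x := (φ, Γ φ)) h1 h2 (by simp)
  have hsplit : ∀ (ψ : E) (t : ℝ), f (ψ, t) = f (ψ, 0) + t * f (0, 1) := by
    intro ψ t
    rw [← smul_eq_mul, ← map_smul, ← map_add]
    simp
  have hneg : f (0, 1) < 0 := by
    have := hf (φ, Γ φ + 1) (by simp)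
    rw [hsplit, hsplit φ (Γ φ)] at this
    linarith
  set c := -f (0, 1) with hcdef
  have hcpos : 0 < c := by linarith
  refine ⟨c⁻¹ • (f.toLinearMap ∘ₗ LinearMap.inl ℝ E ℝ), fun ψ => ?_⟩
  simp only [LinearMap.smul_apply, LinearMap.comp_apply, LinearMap.inl_apply, smul_eq_mul,
    ContinuousLinearMap.coe_coe]
  refine le_of_forall_pos_le_add fun ε hε => ?_
  have := hf (ψ, Γ ψ + ε) (by simpa using hε)
  rw [hsplit, hsplit φ (Γ φ)] at this
  rw [← mul_sub, inv_mul_le_iff₀ hcpos]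
  have h3 : f (0, 1) = -c := by simp [hcdef]
  rw [h3] at this
  nlinarith

/-- Variational principle over invariant measures under cohomology invariance (C4):
`Γ(φ) = sup_{μ∈M_T(X)} ( 𝔥(μ) + ∫φ dμ )`. -/
theorem variational_principle_invariant {X : Type*} [MetricSpace X] [CompactSpace X] [Nonempty X]
    [MeasurableSpace X] [BorelSpace X] (T : X → X) (hT : Continuous T) (Γ : C(X, ℝ) → ℝ)
    (hmono : ∀ φ ψ : C(X, ℝ), (∀ x, φ x ≤ ψ x) → Γ φ ≤ Γ ψ)
    (htrans : ∀ (φ : C(X, ℝ)) (c : ℝ), Γ (φ + ContinuousMap.const X c) = Γ φ + c)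
    (hconv : ∀ φ ψ : C(X, ℝ), ∀ l ∈ Set.Icc (0 : ℝ) 1,
      Γ (l • φ + (1 - l) • ψ) ≤ l * Γ φ + (1 - l) * Γ ψ)
    (hcohom : ∀ φ ψ : C(X, ℝ),
      Γ (φ + ψ - ψ.comp ⟨T, hT⟩) = Γ φ ∧ Γ (φ + ψ.comp ⟨T, hT⟩ - ψ) = Γ φ)
    (φ : C(X, ℝ)) :
    (Γ φ : EReal) =
      ⨆ μ ∈ {μ : ProbabilityMeasure X | (μ : Measure X).map T = (μ : Measure X)},
        (genEntropy Γ (μ : Measure X) + ((∫ x, φ x ∂(μ : Measure X) : ℝ) : EReal)) := by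
  have hlip : ∀ φ ψ : C(X, ℝ), Γ φ ≤ Γ ψ + dist φ ψ := by
    intro φ ψ
    rw [← htrans]
    refine hmono _ _ fun x => ?_
    have h := ContinuousMap.dist_apply_le_dist (f := φ) (g := ψ) x
    rw [Real.dist_eq] at h
    have := le_abs_self (φ x - ψ x)
    simp only [ContinuousMap.add_apply, ContinuousMap.const_apply]
    linarith
  have hcont : Continuous Γ := (LipschitzWith.of_le_add hlip).continuous
  have hcv : ConvexOn ℝ Set.univ Γ := by
    refine ⟨convex_univ, fun a _ b _ s t hs ht hst => ?_⟩
    obtain rfl : t = 1 - s := by linarith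
    exact hconv a b s ⟨hs, by linarith⟩
  have h_intg : ∀ (μ : ProbabilityMeasure X) (ψ : C(X, ℝ)), Integrable (fun x => ψ x) (μ : Measure X) :=
    fun μ ψ => ψ.continuous.integrable_of_hasCompactSupport (HasCompactSupport.of_compactSpace _)
  apply le_antisymm
  · obtain ⟨L, hL⟩ := exists_subgradient Γ hcont hcv φ
    have hL' : ∀ ψ, L ψ ≤ Γ (φ + ψ) - Γ φ := fun ψ => by
      have := hL (φ + ψ)
      rw [map_add] at this
      linarith
    have hpos : ∀ ψ : C(X, ℝ), (∀ x, 0 ≤ ψ x) → 0 ≤ L ψ := by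
      intro ψ hψ
      have h1 := hL' (-ψ)
      have h2 := hmono (φ + -ψ) φ (fun x => by simpa using hψ x)
      rw [map_neg] at h1
      linarith
    have hone : L (ContinuousMap.const X 1) = 1 := by
      have h1 := hL' (ContinuousMap.const X 1)
      have h2 := hL' (ContinuousMap.const X (-1))
      have h3 : (ContinuousMap.const X (-1) : C(X, ℝ)) = -ContinuousMap.const X 1 := by
        ext; simp
      rw [htrans] at h1 h2
      rw [h3, map_neg] at h2
      linarith
    have hinv : ∀ ψ : C(X, ℝ), L (ψ.comp ⟨T, hT⟩) = L ψ := by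
      intro ψ
      have h1 := hL' (ψ - ψ.comp ⟨T, hT⟩)
      have h2 := hL' (ψ.comp ⟨T, hT⟩ - ψ)
      rw [← add_sub_assoc, (hcohom φ ψ).1, map_sub] at h1
      rw [← add_sub_assoc, (hcohom φ ψ).2, map_sub] at h2
      linarith
    obtain ⟨μ, hμ⟩ := exists_prob_of_positive L hpos hone
    have hμT : (μ : Measure X).map T = (μ : Measure X) := by
      have : IsProbabilityMeasure ((μ : Measure X).map T) :=
        Measure.isProbabilityMeasure_map hT.measurable.aemeasurable
      refine ext_of_forall_integral_eq_of_IsFiniteMeasure fun f => ?_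
      rw [integral_map hT.measurable.aemeasurable f.continuous.aestronglyMeasurable]
      exact (hμ (f.toContinuousMap.comp ⟨T, hT⟩)).trans
        ((hinv f.toContinuousMap).trans (hμ f.toContinuousMap).symm)
    refine le_iSup₂_of_le μ hμT ?_
    have hh : ((Γ φ - L φ : ℝ) : EReal) ≤ genEntropy Γ (μ : Measure X) := by
      refine le_iInf₂ fun ξ hξ => ?_
      rw [hμ, EReal.coe_le_coe_iff]
      have h1 := hL (-ξ)
      rw [map_neg] at h1
      have h2 : Γ (-ξ) ≤ 0 := hξ
      linarith
    calc (Γ φ : EReal) = ((Γ φ - L φ : ℝ) : EReal) + ((L φ : ℝ) : EReal) := by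
          rw [← EReal.coe_add, sub_add_cancel]
      _ ≤ _ := by
          rw [hμ]
          gcongr
  · refine iSup₂_le fun μ _ => ?_
    have hmem : Γ (-(ContinuousMap.const X (Γ φ) - φ)) ≤ 0 := by
      have h : -(ContinuousMap.const X (Γ φ) - φ) = φ + ContinuousMap.const X (-Γ φ) := by
        ext x; simp; ring
      rw [h, htrans]
      simp
    have hh : genEntropy Γ (μ : Measure X) ≤
        ((∫ x, (ContinuousMap.const X (Γ φ) - φ) x ∂(μ : Measure X) : ℝ) : EReal) :=
      iInf₂_le (ContinuousMap.const X (Γ φ) - φ) hmem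
    have hval : ∫ x, (ContinuousMap.const X (Γ φ) - φ) x ∂(μ : Measure X)
        = Γ φ - ∫ x, φ x ∂(μ : Measure X) := by
      simp only [ContinuousMap.sub_apply, ContinuousMap.const_apply]
      rw [integral_sub (integrable_const _) (h_intg μ φ)]
      simp
    rw [hval] at hh
    calc _ ≤ ((Γ φ - ∫ x, φ x ∂(μ : Measure X) : ℝ) : EReal)
          + ((∫ x, φ x ∂(μ : Measure X) : ℝ) : EReal) := by gcongr
      _ = _ := by rw [← EReal.coe_add, sub_add_cancel]
end

section
/- Let E be a real Banach space with topological dual E*. Let S ⊆ E be a nonempty closed convex subset and K ⊆ E* a nonempty convex subset that is compact in the weak* topology. Let A : K → ℝ be a finite, weak*-upper semicontinuous, concave function. Then sup_{μ∈K} inf_{ξ∈S} ( ⟨ξ,μ⟩ + A(μ) ) = inf_{ξ∈S} sup_{μ∈K} ( ⟨ξ,μ⟩ + A(μ) ), where ⟨·,·⟩ denotes the natural pairing between E and E*, and infima/suprema are taken in the extended reals. -/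
/-- Minimax via Fenchel–Rockafellar duality: for a nonempty closed convex `S ⊆ E`,
a nonempty convex weak*-compact `K ⊆ E*`, and a finite weak*-upper semicontinuous
concave `A` on `K`,
`sup_{μ∈K} inf_{ξ∈S} (⟨ξ,μ⟩ + A(μ)) = inf_{ξ∈S} sup_{μ∈K} (⟨ξ,μ⟩ + A(μ))`. -/
theorem minimax_weakDual {E : Type*} [NormedAddCommGroup E] [NormedSpace ℝ E]
    [CompleteSpace E] (S : Set E) (hS : S.Nonempty) (hSclosed : IsClosed S)
    (hSconv : Convex ℝ S) (K : Set (WeakDual ℝ E)) (hK : K.Nonempty)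
    (hKconv : Convex ℝ K) (hKcomp : IsCompact K) (A : WeakDual ℝ E → ℝ)
    (hAusc : UpperSemicontinuousOn A K) (hAconc : ConcaveOn ℝ K A) :
    ⨆ μ ∈ K, ⨅ ξ ∈ S, ((μ ξ + A μ : ℝ) : EReal) =
      ⨅ ξ ∈ S, ⨆ μ ∈ K, ((μ ξ + A μ : ℝ) : EReal) := by
  have hu : ∀ ξ ∈ S, UpperSemicontinuousOn
      (fun μ : WeakDual ℝ E => ((μ ξ + A μ : ℝ) : EReal)) K := by
    intro ξ _
    have h1 : UpperSemicontinuousOn (fun μ : WeakDual ℝ E => μ ξ + A μ) K :=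
      ((WeakDual.eval_continuous ξ).continuousOn.upperSemicontinuousOn).add hAusc
    exact continuous_coe_real_ereal.comp_upperSemicontinuousOn h1
      EReal.coe_strictMono.monotone
  have hqc : ∀ ξ ∈ S, QuasiconcaveOn ℝ K
      (fun μ : WeakDual ℝ E => ((μ ξ + A μ : ℝ) : EReal)) := by
    intro ξ _
    have h1 : ConcaveOn ℝ K (fun μ : WeakDual ℝ E => μ ξ + A μ) := by
      refine ⟨hKconv, fun x hx y hy a b ha hb hab => ?_⟩
      have h := hAconc.2 hx hy ha hb hab
      have e : (a • x + b • y) ξ = a * x ξ + b * y ξ := rfl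
      simp only [smul_eq_mul] at h ⊢
      rw [e]
      linarith
    have h2 := h1.quasiconcaveOn.monotone_comp EReal.coe_strictMono.monotone
    exact h2
  have hl : ∀ μ ∈ K, LowerSemicontinuousOn (fun ξ : E => ((μ ξ + A μ : ℝ) : EReal)) S := by
    intro μ _
    have hc : Continuous (fun ξ : E => μ ξ) := ContinuousLinearMap.continuous (μ : E →L[ℝ] ℝ)
    exact (continuous_coe_real_ereal.comp
      (hc.add continuous_const)).continuousOn.lowerSemicontinuousOn
  have hqv : ∀ μ ∈ K, QuasiconvexOn ℝ S (fun ξ : E => ((μ ξ + A μ : ℝ) : EReal)) := by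
    intro μ _
    have h1 : ConvexOn ℝ S (fun ξ : E => μ ξ + A μ) := by
      refine ⟨hSconv, fun x hx y hy a b ha hb hab => ?_⟩
      have e : μ (a • x + b • y) = a * μ x + b * μ y := by simp
      simp only [smul_eq_mul]
      rw [e]
      have : A μ = a * A μ + b * A μ := by rw [← add_mul, hab, one_mul]
      linarith
    have h2 := h1.quasiconvexOn.monotone_comp EReal.coe_strictMono.monotone
    exact h2
  exact Sion.minimax' (β := ERealᵒᵈ) (X := K) (Y := S)
    (f := fun μ ξ => OrderDual.toDual ((μ ξ + A μ : ℝ) : EReal))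
    hK hKconv hKcomp hu hqc hSconv hl hqv
end
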